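/- arXiv:1904.10309 — 6 statements merged into one kernel-verified Lean document; each statement's English description precedes it below -/
import Mathlib

section
/- Let (A,B,C) be a triple of nonempty subsets of a G-metric space (X,G) and let (T;S;K) be a tripartite contraction on A∪B∪C such that T(A) ⊆ S(C) ⊆ K(B), T(B) ⊆ S(A) ⊆ K(C) and T(C) ⊆ S(B) ⊆ K(A). Let (x_n) be a sequence with x_0 ∈ A, x_{3n} ∈ A, x_{3n+1} ∈ C, x_{3n+2} ∈ B for all n, and T x_n = S x_{n+1} = K x_{n+2} for all n ≥ 0. Then G(K x_{3n}, K x_{3n+1}, K x_{3n+2}) → G(A,B,C) as n → ∞. -/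
open Filter Topology Set

/-- A G-metric on `X`. -/
def IsGMetric {X : Type*} (G : X → X → X → ℝ) : Prop :=
  (∀ x y z, 0 ≤ G x y z) ∧
  (∀ x, G x x x = 0) ∧
  (∀ x y, x ≠ y → 0 < G x x y) ∧
  (∀ x y z, z ≠ y → G x x y ≤ G x y z) ∧
  (∀ x y z, G x y z = G x z y) ∧
  (∀ x y z, G x y z = G y z x) ∧
  (∀ x y z a, G x y z ≤ G x a a + G a y z)

/-- `G`-distance of three sets: `inf {G a b c : a ∈ A, b ∈ B, c ∈ C}`. -/
noncomputable def GDist {X : Type*} (G : X → X → X → ℝ) (A B C : Set X) : ℝ :=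
  sInf {d : ℝ | ∃ a ∈ A, ∃ b ∈ B, ∃ c ∈ C, d = G a b c}

/-- `(T;S;K)` is an RLN triple on `A ∪ B ∪ C`:
`T` is right cyclic, `S` is left cyclic and `K` is noncyclic. -/
def IsRLN {X : Type*} (A B C : Set X) (T S K : X → X) : Prop :=
  MapsTo T A B ∧ MapsTo T B C ∧ MapsTo T C A ∧
  MapsTo S A C ∧ MapsTo S C B ∧ MapsTo S B A ∧
  MapsTo K A A ∧ MapsTo K B B ∧ MapsTo K C C

/-- `(T;S;K)` is a tripartite contraction with constant `r`. -/
def TripartiteContraction {X : Type*} (G : X → X → X → ℝ) (A B C : Set X)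
    (T S K : X → X) (r : ℝ) : Prop :=
  IsRLN A B C T S K ∧ 0 < r ∧ r < 1 ∧
  ∀ x ∈ A, ∀ y ∈ B, ∀ z ∈ C,
    G (S x) (S y) (S z) ≤ r * G (K x) (K y) (K z) + (1 - r) * GDist G A B C ∧
    G (T x) (T y) (T z) ≤ r * G (S x) (S y) (S z)

/-- `(T;S;K)` is a tripartite semi-contraction with constant `r`. -/
def TripartiteSemiContraction {X : Type*} (G : X → X → X → ℝ) (A B C : Set X)
    (T S K : X → X) (r : ℝ) : Prop :=
  IsRLN A B C T S K ∧ 0 < r ∧ r < 1 ∧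
  ∀ x ∈ A, ∀ y ∈ B, ∀ z ∈ C,
    G (T x) (S y) (K z) ≤ r * G (K x) (K y) (K z) + (1 - r) * GDist G A B C ∧
    G (S x) (S y) (S z) ≤ r * G (T x) (S y) (K z)

/-- A sequence `u` `G`-converges to `p` iff `G (u n) p p → 0`. -/
def GConv {X : Type*} (G : X → X → X → ℝ) (u : ℕ → X) (p : X) : Prop :=
  Tendsto (fun n => G (u n) p p) atTop (nhds 0)

/-- `f` is `G`-continuous on `D`: it maps `G`-convergent sequences of `D` with limit in `D`
to `G`-convergent sequences, with `f` of the limit as limit. -/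
def GContinuousOn {X : Type*} (G : X → X → X → ℝ) (f : X → X) (D : Set X) : Prop :=
  ∀ (u : ℕ → X) (p : X), (∀ n, u n ∈ D) → p ∈ D → GConv G u p →
    GConv G (fun n => f (u n)) (f p)

/-- A sequence is `G`-bounded. -/
def GBounded {X : Type*} (G : X → X → X → ℝ) (u : ℕ → X) : Prop :=
  ∃ x₀ y₀ : X, ∃ M : ℝ, 0 < M ∧ ∀ n, G (u n) x₀ y₀ ≤ M

/-- `A` is `G`-sequentially compact: every `G`-bounded sequence in `A` has a subsequence
`G`-converging to a point of `A`. -/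
def GSeqCompact {X : Type*} (G : X → X → X → ℝ) (A : Set X) : Prop :=
  ∀ u : ℕ → X, (∀ n, u n ∈ A) → GBounded G u →
    ∃ φ : ℕ → ℕ, StrictMono φ ∧ ∃ p ∈ A, GConv G (fun k => u (φ k)) p

/-- `K` is tripartite relatively anti-Lipschitzian on `A ∪ B ∪ C`. -/
def GAntiLipschitz {X : Type*} (G : X → X → X → ℝ) (K : X → X) (A B C : Set X) : Prop :=
  ∃ c : ℝ, 0 < c ∧ ∀ x ∈ A, ∀ y ∈ B, ∀ z ∈ C, G x y z ≤ c * G (K x) (K y) (K z)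

/-- A convex structure on a `G`-metric space. -/
def GConvexStructure {X : Type*} (G : X → X → X → ℝ)
    (W : X → X → X → ℝ → ℝ → ℝ → X) : Prop :=
  ∀ u v x y z : X, ∀ l₁ l₂ l₃ : ℝ,
    l₁ ∈ Set.Icc (0:ℝ) 1 → l₂ ∈ Set.Icc (0:ℝ) 1 → l₃ ∈ Set.Icc (0:ℝ) 1 →
    l₁ + l₂ + l₃ = 1 →
    G u v (W x y z l₁ l₂ l₃) ≤ l₁ * G u v x + l₂ * G u v y + l₃ * G u v z

/-- `(X, G, W)` is a uniformly convex `G`-metric space. -/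
def UniformlyConvexG {X : Type*} (G : X → X → X → ℝ)
    (W : X → X → X → ℝ → ℝ → ℝ → X) : Prop :=
  GConvexStructure G W ∧
  ∀ ε : ℝ, 0 < ε → ∃ α : ℝ, 0 < α ∧ α < 1 ∧
    ∀ r : ℝ, 0 < r → ∀ u v x y z : X, x ≠ y → y ≠ z → x ≠ z →
      G u v x ≤ r → G u v y ≤ r → G u v z ≤ r → r * ε ≤ G x y z →
      G u v (W x y z (1/3) (1/3) (1/3)) ≤ r * (1 - α)

/-- A subset `U` is `G`-convex with respect to the convex structure `W`. -/
def GConvexSet {X : Type*} (W : X → X → X → ℝ → ℝ → ℝ → X) (U : Set X) : Prop :=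
  ∀ x ∈ U, ∀ y ∈ U, ∀ z ∈ U, ∀ l₁ l₂ l₃ : ℝ,
    l₁ ∈ Set.Icc (0:ℝ) 1 → l₂ ∈ Set.Icc (0:ℝ) 1 → l₃ ∈ Set.Icc (0:ℝ) 1 →
    l₁ + l₂ + l₃ = 1 → W x y z l₁ l₂ l₃ ∈ U

/-- A `G`-Cauchy sequence: `G (u n) (u m) (u l) → 0` as `n, m, l → ∞`. -/
def GCauchy {X : Type*} (G : X → X → X → ℝ) (u : ℕ → X) : Prop :=
  ∀ ε : ℝ, 0 < ε → ∃ N : ℕ, ∀ n ≥ N, ∀ m ≥ N, ∀ l ≥ N, G (u n) (u m) (u l) < ε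

/-- The `G`-metric space is complete: every `G`-Cauchy sequence `G`-converges. -/
def GComplete {X : Type*} (G : X → X → X → ℝ) : Prop :=
  ∀ u : ℕ → X, GCauchy G u → ∃ p, GConv G u p

/-- `A` is closed: it contains all `G`-limits of its sequences. -/
def GClosed {X : Type*} (G : X → X → X → ℝ) (A : Set X) : Prop :=
  ∀ u : ℕ → X, (∀ n, u n ∈ A) → ∀ p, GConv G u p → p ∈ A

/-- The iterative sequence associated to the triple `(T;S;K)`:
`x₀ ∈ A`, `x_{3n} ∈ A`, `x_{3n+1} ∈ C`, `x_{3n+2} ∈ B` and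
`T x_n = S x_{n+1} = K x_{n+2}` for all `n ≥ 0`. -/
def IterSeq {X : Type*} (A B C : Set X) (T S K : X → X) (x : ℕ → X) : Prop :=
  x 0 ∈ A ∧ (∀ n, x (3*n) ∈ A) ∧ (∀ n, x (3*n+1) ∈ C) ∧ (∀ n, x (3*n+2) ∈ B) ∧
  (∀ n, T (x n) = S (x (n+1)) ∧ S (x (n+1)) = K (x (n+2)))

/-- Lemma 3.9: `G(K x_{3n}, K x_{3n+1}, K x_{3n+2}) → G(A,B,C)`. -/
theorem tripartite_contraction_KDist_tendsto
    {X : Type*} (G : X → X → X → ℝ) (hG : IsGMetric G)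
    (A B C : Set X) (hA : A.Nonempty) (hB : B.Nonempty) (hC : C.Nonempty)
    (T S K : X → X) (r : ℝ)
    (hTSK : TripartiteContraction G A B C T S K r)
    (hTA : T '' A ⊆ S '' C) (hSC : S '' C ⊆ K '' B)
    (hTB : T '' B ⊆ S '' A) (hSA : S '' A ⊆ K '' C)
    (hTC : T '' C ⊆ S '' B) (hSB : S '' B ⊆ K '' A)
    (x : ℕ → X) (hx : IterSeq A B C T S K x) :
    Tendsto (fun n => G (K (x (3*n))) (K (x (3*n+1))) (K (x (3*n+2)))) atTop
      (nhds (GDist G A B C)) := by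
  obtain ⟨⟨-, -, -, -, -, -, KA, KB, KC⟩, r0, r1, hc⟩ := hTSK
  obtain ⟨-, xA, xC, xB, hrec⟩ := hx
  obtain ⟨hpos, -, -, -, hs1, hs2, -⟩ := hG
  have hD : ∀ a ∈ A, ∀ b ∈ B, ∀ c ∈ C, GDist G A B C ≤ G a b c := by
    intro a ha b hb c hc'
    refine csInf_le ⟨0, ?_⟩ ⟨a, ha, b, hb, c, hc', rfl⟩
    rintro d ⟨a, -, b, -, c, -, rfl⟩
    exact hpos a b c
  have key : ∀ n, ∃ a ∈ A, ∃ b ∈ B, ∃ c ∈ C, ∀ f : X → X,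
      G (f (x n)) (f (x (n+1))) (f (x (n+2))) = G (f a) (f b) (f c) := by
    intro n
    obtain ⟨m, h | h | h⟩ : ∃ m, n = 3*m ∨ n = 3*m+1 ∨ n = 3*m+2 := ⟨n/3, by omega⟩
    · subst h
      exact ⟨_, xA m, _, xB m, _, xC m, fun f => hs1 _ _ _⟩
    · subst h
      refine ⟨_, xA (m+1), _, xB m, _, xC m, fun f => ?_⟩
      have e : 3*m+1+2 = 3*(m+1) := by ring
      rw [e]
      exact (hs2 _ _ _).trans ((hs2 _ _ _).trans (hs1 _ _ _))
    · subst h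
      refine ⟨_, xA (m+1), _, xB m, _, xC (m+1), fun f => ?_⟩
      have e : 3*m+2+1 = 3*(m+1) := by ring
      have e' : 3*m+2+2 = 3*(m+1)+1 := by ring
      rw [e, e']
      exact (hs2 _ _ _).trans (hs1 _ _ _)
  set D := GDist G A B C
  let g : ℕ → ℝ := fun n => G (K (x n)) (K (x (n+1))) (K (x (n+2)))
  have hlow : ∀ n, D ≤ g n := by
    intro n
    obtain ⟨a, ha, b, hb, c, hc', h⟩ := key n
    have := hD _ (KA ha) _ (KB hb) _ (KC hc')
    rw [← h K] at this
    exact this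
  have hstep : ∀ n, g (n+1+1) ≤ r * g (n+1) + (1-r) * D := by
    intro n
    obtain ⟨a, ha, b, hb, c, hc', h⟩ := key (n+1)
    have := (hc a ha b hb c hc').1
    rw [← h K, ← h S, (hrec n).2, (hrec (n+1)).2, (hrec (n+2)).2] at this
    exact this
  have hup : ∀ n, g (n+1) ≤ D + r^n * (g 1 - D) := by
    intro n
    induction n with
    | zero => simp
    | succ n ih =>
      have h1 := hstep n
      have h2 := mul_le_mul_of_nonneg_left ih r0.le
      rw [pow_succ]
      nlinarith
  have hlim : Tendsto (fun n => g (n+1)) atTop (nhds D) := by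
    refine tendsto_of_tendsto_of_tendsto_of_le_of_le tendsto_const_nhds ?_
      (fun n => hlow (n+1)) hup
    have := ((tendsto_pow_atTop_nhds_zero_of_lt_one r0.le r1).mul_const (g 1 - D)).const_add D
    simpa using this
  have hlim' : Tendsto g atTop (nhds D) := (tendsto_add_atTop_iff_nat 1).1 hlim
  exact hlim'.comp (tendsto_id.const_mul_atTop' (by norm_num : 0 < 3))
end

section
/- Let (A,B,C) be a triple of nonempty subsets of a G-metric space (X,G) and let (T;S;K) be a tripartite contraction on A∪B∪C such that T(A) ⊆ S(C) ⊆ K(B), T(B) ⊆ S(A) ⊆ K(C), T(C) ⊆ S(B) ⊆ K(A), and such that K is G-continuous on A∪B∪C. Let (x_n) be a sequence with x_0 ∈ A, x_{3n} ∈ A, x_{3n+1} ∈ C, x_{3n+2} ∈ B for all n, and T x_n = S x_{n+1} = K x_{n+2} for all n ≥ 0. If (x_{3n}) has a subsequence that G-converges to a point of A, then there exists p ∈ A with G(Kp, Tp, Sp) = G(A,B,C), i.e. (T;S;K) has a tripartite coincidence-best proximity point in A. -/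
open Filter Topology Set

/-- Theorem 3.10: existence of a tripartite coincidence-best proximity point
assuming a `G`-convergent subsequence of `(x_{3n})` in `A`. -/
theorem tripartite_contraction_best_proximity_of_subseq
    {X : Type*} (G : X → X → X → ℝ) (hG : IsGMetric G)
    (A B C : Set X) (hA : A.Nonempty) (hB : B.Nonempty) (hC : C.Nonempty)
    (T S K : X → X) (r : ℝ)
    (hTSK : TripartiteContraction G A B C T S K r)
    (hTA : T '' A ⊆ S '' C) (hSC : S '' C ⊆ K '' B)
    (hTB : T '' B ⊆ S '' A) (hSA : S '' A ⊆ K '' C)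
    (hTC : T '' C ⊆ S '' B) (hSB : S '' B ⊆ K '' A)
    (hK : GContinuousOn G K (A ∪ B ∪ C))
    (x : ℕ → X) (hx : IterSeq A B C T S K x)
    (hsub : ∃ φ : ℕ → ℕ, StrictMono φ ∧ ∃ q ∈ A, GConv G (fun k => x (3 * φ k)) q) :
    ∃ p ∈ A, G (K p) (T p) (S p) = GDist G A B C := by
  obtain ⟨h0, hxx, hpos, hle, hs1, hs2, hrect⟩ := hG
  obtain ⟨⟨tA, tB, tC, sA, sC, sB, kA, kB, kC⟩, hr0, hr1, hcon⟩ := hTSK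
  obtain ⟨-, xA, xC, xB, hrec⟩ := hx
  obtain ⟨φ, hφ, q, hq, hconv⟩ := hsub
  have hbdd : BddBelow {d : ℝ | ∃ a ∈ A, ∃ b ∈ B, ∃ c ∈ C, d = G a b c} := by
    refine ⟨0, ?_⟩
    rintro d ⟨a, -, b, -, c, -, rfl⟩
    exact h0 a b c
  have hD0 : 0 ≤ GDist G A B C := by
    apply Real.sInf_nonneg
    rintro d ⟨a, -, b, -, c, -, rfl⟩
    exact h0 a b c
  have hDle : ∀ a ∈ A, ∀ b ∈ B, ∀ c ∈ C, GDist G A B C ≤ G a b c := by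
    intro a ha b hb c hc
    exact csInf_le hbdd ⟨a, ha, b, hb, c, hc, rfl⟩
  -- doubling
  have hdbl : ∀ a b, G a b b ≤ 2 * G b a a := by
    intro a b
    have e1 := hrect b b a a
    have e2 := hs2 a b b
    have e3 := hs2 a b a
    linarith
  have htwo : ∀ u b c, G u b b ≤ 2 * G u b c := by
    intro u b c
    by_cases h : c = u
    · subst h
      have e1 := hdbl c b
      have e2 := hs2 c b c
      have e3 := hs2 c c b
      linarith
    · have e1 := hle b u c h
      have e2 := hs2 u b b
      have e3 := hs2 b u c
      have e4 := hs1 u c b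
      have e5 := h0 u b c
      linarith
  -- geometric decay
  have hstep : ∀ n, G (T (x (n+1))) (T (x (n+2))) (T (x (n+3)))
      ≤ r * G (T (x n)) (T (x (n+1))) (T (x (n+2))) := by
    intro n
    have key : G (T (x (n+1))) (T (x (n+2))) (T (x (n+3)))
      ≤ r * G (S (x (n+1))) (S (x (n+2))) (S (x (n+3))) := by
      obtain ⟨m, hm | hm | hm⟩ : ∃ m, n + 1 = 3*m ∨ n + 1 = 3*m+1 ∨ n + 1 = 3*m+2 :=
        ⟨(n+1)/3, by omega⟩
      · have a1 : x (n+1) ∈ A := by rw [hm]; exact xA m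
        have a2 : x (n+2) ∈ C := by
          rw [show n+2 = 3*m+1 by omega]; exact xC m
        have a3 : x (n+3) ∈ B := by
          rw [show n+3 = 3*m+2 by omega]; exact xB m
        have e := (hcon _ a1 _ a3 _ a2).2
        rwa [hs1 (T _), hs1 (S _)] at e
      · have a1 : x (n+1) ∈ C := by rw [hm]; exact xC m
        have a2 : x (n+2) ∈ B := by
          rw [show n+2 = 3*m+2 by omega]; exact xB m
        have a3 : x (n+3) ∈ A := by
          rw [show n+3 = 3*(m+1) by omega]; exact xA _
        have e := (hcon _ a3 _ a2 _ a1).2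
        rwa [hs2 (T _), hs1 (T _), hs2 (T _), hs2 (T _), hs2 (S _), hs1 (S _),
          hs2 (S _), hs2 (S _)] at e
      · have a1 : x (n+1) ∈ B := by rw [hm]; exact xB m
        have a2 : x (n+2) ∈ A := by
          rw [show n+2 = 3*(m+1) by omega]; exact xA _
        have a3 : x (n+3) ∈ C := by
          rw [show n+3 = 3*(m+1)+1 by omega]; exact xC _
        have e := (hcon _ a2 _ a1 _ a3).2
        rwa [hs1 (T _), hs2 (T _), hs2 (T _), hs1 (S _), hs2 (S _), hs2 (S _)] at e
    rw [(hrec n).1, (hrec (n+1)).1, (hrec (n+2)).1] at *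
    exact key
  have hpow : ∀ n, G (T (x n)) (T (x (n+1))) (T (x (n+2)))
      ≤ r ^ n * G (T (x 0)) (T (x 1)) (T (x 2)) := by
    intro n
    induction n with
    | zero => simp
    | succ k ih =>
      calc _ ≤ _ := hstep k
        _ ≤ r * _ := mul_le_mul_of_nonneg_left ih hr0.le
        _ = _ := by ring
  have hTlim : Tendsto (fun n => G (T (x n)) (T (x (n+1))) (T (x (n+2)))) atTop (𝓝 0) := by
    refine squeeze_zero (fun n => h0 _ _ _) hpow ?_
    simpa using (tendsto_pow_atTop_nhds_zero_of_lt_one hr0.le hr1).mul_const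
      (G (T (x 0)) (T (x 1)) (T (x 2)))
  have hKlim : Tendsto (fun n => G (K (x n)) (K (x (n+1))) (K (x (n+2)))) atTop (𝓝 0) := by
    rw [← tendsto_add_atTop_iff_nat 2]
    refine hTlim.congr fun n => ?_
    have hTK : ∀ n, T (x n) = K (x (n+2)) := fun n => (hrec n).1.trans (hrec n).2
    rw [hTK, hTK, hTK]
  have h3φ : Tendsto (fun k => 3 * φ k) atTop atTop :=
    tendsto_atTop_mono (fun k => by have := hφ.id_le k; simp only [id] at this ⊢; omega) tendsto_id
  have hKs := hKlim.comp h3φ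
  have hD : GDist G A B C = 0 := by
    refine le_antisymm (ge_of_tendsto' hKs fun k => ?_) hD0
    have e := hDle _ (kA (xA (φ k))) _ (kB (xB (φ k))) _ (kC (xC (φ k)))
    rw [hs1] at e
    exact e
  rw [hD] at hcon ⊢
  have hKq : Tendsto (fun k => G (K (x (3 * φ k))) (K q) (K q)) atTop (𝓝 0) :=
    hK _ q (fun k => Or.inl (Or.inl (xA _))) (Or.inl (Or.inl hq)) hconv
  have hElim : Tendsto (fun k => 2 * G (K (x (3 * φ k))) (K q) (K q)
      + G (K (x (3 * φ k))) (K (x (3 * φ k+1))) (K (x (3 * φ k+2)))) atTop (𝓝 0) := by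
    simpa using (hKq.const_mul 2).add hKs
  have hE : ∀ k, G (K q) (K (x (3 * φ k+2))) (K (x (3 * φ k+1))) ≤
      2 * G (K (x (3 * φ k))) (K q) (K q)
      + G (K (x (3 * φ k))) (K (x (3 * φ k+1))) (K (x (3 * φ k+2))) := by
    intro k
    have e1 := hrect (K q) (K (x (3 * φ k+2))) (K (x (3 * φ k+1))) (K (x (3 * φ k)))
    have e2 := hdbl (K q) (K (x (3 * φ k)))
    have e3 := hs1 (K (x (3 * φ k))) (K (x (3 * φ k+1))) (K (x (3 * φ k+2)))
    linarith
  have heLim := squeeze_zero (fun k => h0 _ _ _) hE hElim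
  have heq : ∀ a b, (∀ k, G a b b ≤
      6 * G (K q) (K (x (3 * φ k+2))) (K (x (3 * φ k+1)))) → a = b := by
    intro a b h
    by_contra hne
    have e1 : G a b b ≤ 0 := ge_of_tendsto' (by simpa using heLim.const_mul 6) h
    have e2 := hpos b a (Ne.symm hne)
    have e3 := hs2 a b b
    linarith
  have hSb : ∀ k, G (S q) (S (x (3 * φ k+2))) (S (x (3 * φ k+1))) ≤
      G (K q) (K (x (3 * φ k+2))) (K (x (3 * φ k+1))) := by
    intro k
    have e := (hcon _ hq _ (xB (φ k)) _ (xC (φ k))).1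
    have e2 := h0 (K q) (K (x (3 * φ k+2))) (K (x (3 * φ k+1)))
    nlinarith
  have hTb : ∀ k, G (T q) (T (x (3 * φ k+2))) (T (x (3 * φ k+1))) ≤
      G (K q) (K (x (3 * φ k+2))) (K (x (3 * φ k+1))) := by
    intro k
    have e := (hcon _ hq _ (xB (φ k)) _ (xC (φ k))).2
    have e2 := h0 (S q) (S (x (3 * φ k+2))) (S (x (3 * φ k+1)))
    have e3 := hSb k
    nlinarith
  have hSq : S q = K q := by
    apply heq
    intro k
    have e0 : S (x (3 * φ k+1)) = K (x (3 * φ k+2)) := (hrec (3 * φ k)).2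
    have e1 := hSb k
    have e2 := htwo (S q) (S (x (3 * φ k+1))) (S (x (3 * φ k+2)))
    rw [hs1 (S q) (S (x (3 * φ k+1)))  (S (x (3 * φ k+2)))] at e2
    have e3 := htwo (K q) (K (x (3 * φ k+2))) (K (x (3 * φ k+1)))
    have e4 := hrect (S q) (K q) (K q) (S (x (3 * φ k+1)))
    have e5 := hdbl (S (x (3 * φ k+1))) (K q)
    rw [← e0] at *
    linarith
  have hTq : T q = S q := by
    apply heq
    intro k
    have e0 : T (x (3 * φ k+1)) = S (x (3 * φ k+2)) := (hrec (3 * φ k+1)).1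
    have e1 := hSb k
    have e1' := hTb k
    have e2 := htwo (T q) (T (x (3 * φ k+1))) (T (x (3 * φ k+2)))
    rw [hs1 (T q) (T (x (3 * φ k+1)))  (T (x (3 * φ k+2)))] at e2
    have e3 := htwo (S q) (S (x (3 * φ k+2))) (S (x (3 * φ k+1)))
    have e4 := hrect (T q) (S q) (S q) (S (x (3 * φ k+2)))
    have e5 := hdbl (S (x (3 * φ k+2))) (S q)
    rw [e0] at *
    linarith
  refine ⟨q, hq, ?_⟩
  rw [hTq, hSq]
  exact hxx _
end

section
/- Let (A,B,C) be a triple of nonempty subsets of a G-metric space (X,G) and let (T;S;K) be a tripartite contraction on A∪B∪C such that T(A) ⊆ S(C) ⊆ K(B), T(B) ⊆ S(A) ⊆ K(C), T(C) ⊆ S(B) ⊆ K(A), and such that S and K commute on A∪C (K(Sx) = S(Kx) for all x ∈ A∪C). Let (x_n) be a sequence with x_0 ∈ A, x_{3n} ∈ A, x_{3n+1} ∈ C, x_{3n+2} ∈ B for all n, and T x_n = S x_{n+1} = K x_{n+2} for all n ≥ 0. Then (K x_{3n}), (K x_{3n+1}) and (K x_{3n+2}) are G-bounded sequences in A, C and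 B respectively. -/
open Filter Topology Set

/-- Lemma 3.12: `(K x_{3n})`, `(K x_{3n+1})`, `(K x_{3n+2})` are
`G`-bounded sequences in `A`, `C` and `B` respectively. -/
theorem tripartite_contraction_K_bounded
    {X : Type*} (G : X → X → X → ℝ) (hG : IsGMetric G)
    (A B C : Set X) (hA : A.Nonempty) (hB : B.Nonempty) (hC : C.Nonempty)
    (T S K : X → X) (r : ℝ)
    (hTSK : TripartiteContraction G A B C T S K r)
    (hTA : T '' A ⊆ S '' C) (hSC : S '' C ⊆ K '' B)
    (hTB : T '' B ⊆ S '' A) (hSA : S '' A ⊆ K '' C)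
    (hTC : T '' C ⊆ S '' B) (hSB : S '' B ⊆ K '' A)
    (hcomm : ∀ x ∈ A ∪ C, K (S x) = S (K x))
    (x : ℕ → X) (hx : IterSeq A B C T S K x) :
    (GBounded G (fun n => K (x (3*n))) ∧ ∀ n, K (x (3*n)) ∈ A) ∧
    (GBounded G (fun n => K (x (3*n+1))) ∧ ∀ n, K (x (3*n+1)) ∈ C) ∧
    (GBounded G (fun n => K (x (3*n+2))) ∧ ∀ n, K (x (3*n+2)) ∈ B) := by
  obtain ⟨g0, g1, g2, g3, gs, gc, gr⟩ := hG
  obtain ⟨⟨-, -, -, -, -, -, kA, kB, kC⟩, hr0, hr1, hcon⟩ := hTSK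
  obtain ⟨-, xA, xC, xB, hrec⟩ := hx
  have hrev : ∀ a b c, G a b c = G c b a := fun a b c => by
    rw [gs a b c, gc a c b]
  have hperm : ∀ a b c, G a b c = G b a c := fun a b c => by
    rw [gc a b c, gs b c a]
  have hstep : ∀ n, G (K (x (n+3))) (K (x (n+4))) (K (x (n+5)))
      ≤ r * G (K (x (n+2))) (K (x (n+3))) (K (x (n+4))) := by
    intro n
    have t : ∀ m, T (x m) = K (x (m+2)) := fun m => (hrec m).1.trans (hrec m).2
    have s : ∀ m, S (x (m+1)) = K (x (m+2)) := fun m => (hrec m).2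
    have key : G (T (x (n+1))) (T (x (n+2))) (T (x (n+3)))
        ≤ r * G (S (x (n+1))) (S (x (n+2))) (S (x (n+3))) := by
      obtain ⟨m, h | h | h⟩ : ∃ m, n = 3*m ∨ n = 3*m+1 ∨ n = 3*m+2 := ⟨n/3, by omega⟩
      · subst h
        have h := (hcon _ (xA (m+1)) _ (xB m) _ (xC m)).2
        rw [hrev, hrev (S _)] at h
        exact h
      · subst h
        have h := (hcon _ (xA (m+1)) _ (xB m) _ (xC (m+1))).2
        rw [hperm, hperm (S _)] at h
        exact h
      · subst h
        have h := (hcon _ (xA (m+1)) _ (xB (m+1)) _ (xC (m+1))).2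
        rw [gs, gs (S _)] at h
        exact h
    rw [t, t, t, s n, s (n+1), s (n+2)] at key
    exact key
  have hgeo : ∀ n, G (K (x (n+2))) (K (x (n+3))) (K (x (n+4)))
      ≤ r ^ n * G (K (x 2)) (K (x 3)) (K (x 4)) := by
    intro n
    induction n with
    | zero => simp
    | succ n ih =>
      refine (hstep n).trans ?_
      rw [pow_succ', mul_assoc]
      exact mul_le_mul_of_nonneg_left ih hr0.le
  have hd : ∀ a b c, G b a a ≤ 2 * G a b c := by
    intro a b c
    by_cases h : c = b
    · subst h
      have h1 := gr c a a c
      have h2 := gr a a c c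
      have h3 : G c a a = G a a c := gc c a a
      have h4 : G c a c = G a c c := by rw [gc c a c]
      linarith
    · have h1 := g3 a b c h
      have h2 := g0 a b c
      have h3 : G b a a = G a a b := gc b a a
      linarith
  set M := G (K (x 2)) (K (x 3)) (K (x 4)) with hM
  have hM0 : 0 ≤ M := g0 _ _ _
  set p := K (x 2) with hp
  have hsum : ∀ n, (1 - r) * G (K (x (n+2))) p p ≤ 2 * M * (1 - r ^ n) := by
    intro n
    induction n with
    | zero => simp [← hp, g1]
    | succ n ih =>
      have h1 := gr (K (x (n+3))) p p (K (x (n+2)))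
      have h2 := hd (K (x (n+2))) (K (x (n+3))) (K (x (n+4)))
      have h3 := hgeo n
      have h4 : G (K (x (n+3))) p p ≤ 2 * (r ^ n * M) + G (K (x (n+2))) p p := by linarith
      have h5 := mul_le_mul_of_nonneg_left h4 (sub_nonneg.2 hr1.le)
      have h6 : n + 1 + 2 = n + 3 := by omega
      rw [h6, pow_succ]
      nlinarith
  have hr2 : 0 < 1 - r := by linarith
  have hq : 0 ≤ 2 * M / (1 - r) := by positivity
  have hb : ∀ n, G (K (x n)) p p ≤ 2 * M / (1 - r) + G (K (x 0)) p p + G (K (x 1)) p p + 1 := by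
    intro n
    have e0 := g0 (K (x 0)) p p
    have e1 := g0 (K (x 1)) p p
    match n with
    | 0 => linarith
    | 1 => linarith
    | n+2 =>
      have h : G (K (x (n+2))) p p ≤ 2 * M / (1 - r) := by
        rw [le_div_iff₀ hr2]
        have := hsum n
        have h7 : 0 ≤ M * r ^ n := by positivity
        linarith
      linarith
  have hpos : 0 < 2 * M / (1 - r) + G (K (x 0)) p p + G (K (x 1)) p p + 1 := by
    have e0 := g0 (K (x 0)) p p
    have e1 := g0 (K (x 1)) p p
    linarith
  exact ⟨⟨⟨p, p, _, hpos, fun n => hb _⟩, fun n => kA (xA n)⟩,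
    ⟨⟨p, p, _, hpos, fun n => hb _⟩, fun n => kC (xC n)⟩,
    ⟨⟨p, p, _, hpos, fun n => hb _⟩, fun n => kB (xB n)⟩⟩
end

section
/- Let (A,B,C) be a triple of nonempty subsets of a G-metric space (X,G) and let (T;S;K) be a tripartite semi-contraction on A∪B∪C such that T(A) ⊆ S(C) ⊆ K(B), T(B) ⊆ S(A) ⊆ K(C) and T(C) ⊆ S(B) ⊆ K(A). Then there exists a sequence (x_n) in X such that x_0 ∈ A, x_{3n} ∈ A, x_{3n+1} ∈ C, x_{3n+2} ∈ B for all n, T x_n = S x_{n+1} = K x_{n+2} for all n ≥ 0, and G(T x_{3n}, T x_{3n+1}, T x_{3n+2}) → 0 as n → ∞. -/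
open Filter Topology Set

/-- Lemma 4.4: existence of the iterative sequence for a tripartite
semi-contraction and `G(T x_{3n}, T x_{3n+1}, T x_{3n+2}) → 0`. -/
theorem tripartite_semi_contraction_iter_seq_exists
    {X : Type*} (G : X → X → X → ℝ) (hG : IsGMetric G)
    (A B C : Set X) (hA : A.Nonempty) (hB : B.Nonempty) (hC : C.Nonempty)
    (T S K : X → X) (r : ℝ)
    (hTSK : TripartiteSemiContraction G A B C T S K r)
    (hTA : T '' A ⊆ S '' C) (hSC : S '' C ⊆ K '' B)
    (hTB : T '' B ⊆ S '' A) (hSA : S '' A ⊆ K '' C)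
    (hTC : T '' C ⊆ S '' B) (hSB : S '' B ⊆ K '' A) :
    ∃ x : ℕ → X, IterSeq A B C T S K x ∧
      Tendsto (fun n => G (T (x (3*n))) (T (x (3*n+1))) (T (x (3*n+2)))) atTop (nhds 0) := by
  obtain ⟨g0, g1, g2, g3, g4, g5, g6⟩ := hG
  obtain ⟨⟨tA, tB, tC, sA, sC, sB, kA, kB, kC⟩, r0, r1, h⟩ := hTSK
  -- basic facts on `G`
  have eqz : ∀ x y, (∀ ε > 0, G x x y ≤ ε) → x = y := by
    intro x y hh
    by_contra hne
    have h1 := g2 x y hne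
    have h2 := hh (G x x y / 2) (by linarith)
    linarith
  have dbl : ∀ x y, G x y y ≤ 2 * G x x y := by
    intro x y
    have h1 := g6 y y x x
    have h2 := g5 x y y
    have h3 := g5 x x y
    have h4 := g5 x y x
    linarith
  have pair : ∀ x y z, G x x y ≤ 2 * G x y z := by
    intro x y z
    by_cases hz : z = y
    · subst hz
      have h1 := dbl z x
      have h2 := g5 z x x
      have h3 := g5 z z x
      have h4 := g5 x z z
      linarith
    · have h1 := g3 x y z hz
      have h2 := g0 x y z
      linarith
  have tri : ∀ a b c d w, G a b w ≤ G a c c + G b d d + G c d w := by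
    intro a b c d w
    have h1 := g6 a b w c
    have h2 := g6 b w c d
    have h3 := g5 c b w
    have h4 := g5 c d w
    linarith
  -- the images under `K` have distance zero
  obtain ⟨a, ha⟩ := hA
  obtain ⟨b, hb⟩ := hB
  obtain ⟨c, hc⟩ := hC
  set P : Set ℝ := {d | ∃ x ∈ A, ∃ y ∈ B, ∃ z ∈ C, d = G (K x) (K y) (K z)} with hP
  have Pne : P.Nonempty := ⟨_, a, ha, b, hb, c, hc, rfl⟩
  have Pbd : BddBelow P := ⟨0, by rintro _ ⟨x, -, y, -, z, -, rfl⟩; exact g0 _ _ _⟩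
  have DI : GDist G A B C ≤ sInf P := by
    apply le_csInf Pne
    rintro _ ⟨x, hx, y, hy, z, hz, rfl⟩
    apply csInf_le
    · exact ⟨0, by rintro _ ⟨x, -, y, -, z, -, rfl⟩; exact g0 _ _ _⟩
    · exact ⟨_, kA hx, _, kB hy, _, kC hz, rfl⟩
  have I0 : sInf P ≤ 0 := by
    by_contra hpos
    push Not at hpos
    have hδ : 0 < (1 - r) * sInf P := mul_pos (by linarith) hpos
    obtain ⟨_, ⟨x, hx, y, hy, z, hz, rfl⟩, hlt⟩ :=
      exists_lt_of_csInf_lt Pne (lt_add_of_pos_right (sInf P) hδ)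
    obtain ⟨h1, h2⟩ := h x hx y hy z hz
    obtain ⟨z', hz', ez⟩ := hSA ⟨x, hx, rfl⟩
    obtain ⟨x', hx', ex⟩ := hSB ⟨y, hy, rfl⟩
    obtain ⟨y', hy', ey⟩ := hSC ⟨z, hz, rfl⟩
    have h3 : sInf P ≤ G (K x') (K y') (K z') := csInf_le Pbd ⟨_, hx', _, hy', _, hz', rfl⟩
    rw [ex, ey, ez, ← g5] at h3
    have h4 : (1 - r) * GDist G A B C ≤ (1 - r) * sInf P :=
      mul_le_mul_of_nonneg_left DI (by linarith)
    have h5 : G (T x) (S y) (K z) < r * (sInf P + (1 - r) * sInf P) + (1 - r) * sInf P := by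
      have := mul_lt_mul_of_pos_left hlt r0
      linarith
    have h6 := mul_lt_mul_of_pos_left h5 r0
    have h7 : r * (r * (sInf P + (1 - r) * sInf P) + (1 - r) * sInf P) ≤ sInf P := by
      have : 0 ≤ sInf P * ((1 - r) * (1 - r * r) + 0) := by
        apply mul_nonneg hpos.le
        have := mul_nonneg (sub_nonneg.2 r1.le) (show 0 ≤ 1 - r * r by nlinarith)
        linarith
      nlinarith
    linarith
  have h1 : ∀ x ∈ A, ∀ y ∈ B, ∀ z ∈ C, G (T x) (S y) (K z) ≤ r * G (K x) (K y) (K z) := by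
    intro x hx y hy z hz
    have := (h x hx y hy z hz).1
    have h4 : (1 - r) * GDist G A B C ≤ 0 :=
      mul_nonpos_of_nonneg_of_nonpos (by linarith) (by linarith)
    linarith
  have h2 : ∀ x ∈ A, ∀ y ∈ B, ∀ z ∈ C, G (S x) (S y) (S z) ≤ r * G (T x) (S y) (K z) :=
    fun x hx y hy z hz => (h x hx y hy z hz).2
  have small : ∀ ε > 0, ∃ x ∈ A, ∃ y ∈ B, ∃ z ∈ C, G (K x) (K y) (K z) < ε ∧
      G (T x) (S y) (K z) < ε := by
    intro ε hε
    obtain ⟨_, ⟨x, hx, y, hy, z, hz, rfl⟩, hlt⟩ :=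
      exists_lt_of_csInf_lt Pne (lt_of_le_of_lt I0 hε)
    refine ⟨x, hx, y, hy, z, hz, hlt, ?_⟩
    have := h1 x hx y hy z hz
    have h0 := g0 (K x) (K y) (K z)
    nlinarith
  -- `K` is constant on `C`
  have Kc : ∀ w ∈ C, ∀ w' ∈ C, K w = K w' := by
    intro w hw w' hw'
    apply eqz
    intro ε hε
    obtain ⟨x, hx, y, hy, z, hz, e1, e2⟩ := small ((1 - r) * ε / 36)
      (by have : 0 < (1 - r) * ε := mul_pos (by linarith) hε
          linarith)
    have key : ∀ v ∈ C, G (K z) (K z) (K v) ≤ 2 * ε / 9 := by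
      intro v hv
      have q1 := tri (K z) (K z) (T x) (S y) (K v)
      have q2 := h1 x hx y hy v hv
      have q3 := tri (K x) (K y) (K z) (K z) (K v)
      have q4 : G (K z) (T x) (T x) ≤ 2 * G (T x) (S y) (K z) := by
        have := pair (T x) (K z) (S y)
        rw [g4 (T x) (K z) (S y)] at this
        rw [g5]; exact this
      have q5 : G (K z) (S y) (S y) ≤ 2 * G (T x) (S y) (K z) := by
        have := pair (S y) (K z) (T x)
        rw [← g5 (T x)] at this
        rw [g5]; exact this
      have q6 : G (K x) (K z) (K z) ≤ 2 * G (K x) (K y) (K z) := by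
        have := pair (K z) (K x) (K y)
        rw [← g5 (K x) (K y) (K z) |>.trans (g5 _ _ _)] at this
        rw [g5]; exact this
      have q7 : G (K y) (K z) (K z) ≤ 2 * G (K x) (K y) (K z) := by
        have := pair (K z) (K y) (K x)
        rw [g4 (K z) (K y) (K x), g5 (K z) (K x) (K y)] at this
        rw [g5]; exact this
      have q8 := mul_le_mul_of_nonneg_left q3 r0.le
      have n1 := g0 (K x) (K z) (K z)
      have n2 := g0 (K y) (K z) (K z)
      have q9 : r * (G (K x) (K z) (K z) + G (K y) (K z) (K z)) ≤
          G (K x) (K z) (K z) + G (K y) (K z) (K z) :=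
        mul_le_of_le_one_left (by linarith) r1.le
      have : (1 - r) * G (K z) (K z) (K v) ≤ (1 - r) * (2 * ε / 9) := by linarith
      exact le_of_mul_le_mul_left this (by linarith)
    have k1 := key w hw
    have k2 := key w' hw'
    have p1 := tri (K w) (K w) (K z) (K z) (K w')
    have p2 : G (K w) (K z) (K z) = G (K z) (K z) (K w) := g5 _ _ _
    linarith
  obtain ⟨p, hp⟩ : ∃ p, ∀ z ∈ C, K z = p := ⟨K c, fun z hz => Kc z hz c hc⟩
  have SA : ∀ x ∈ A, S x = p := by
    intro x hx
    obtain ⟨z, hz, e⟩ := hSA ⟨x, hx, rfl⟩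
    rw [← e, hp z hz]
  have SC : ∀ z ∈ C, S z = p := by
    intro w hw
    symm
    apply eqz
    intro ε hε
    obtain ⟨x, hx, y, hy, z, hz, e1, e2⟩ := small (ε / 2) (by linarith)
    have q1 := h2 x hx y hy w hw
    rw [hp w hw, SA x hx] at q1
    rw [hp z hz] at e2
    have q2 := pair p (S w) (S y)
    rw [g4 p (S w) (S y)] at q2
    have q3 := g0 (T x) (S y) p
    nlinarith
  have TA : ∀ x ∈ A, T x = p := by
    intro x hx
    obtain ⟨z, hz, e⟩ := hTA ⟨x, hx, rfl⟩
    rw [← e, SC z hz]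
  have SB : ∀ y ∈ B, S y = p := by
    intro y hy
    have q1 := h2 a ha y hy c hc
    rw [SA a ha, SC c hc, TA a ha, hp c hc] at q1
    have q2 := g0 p (S y) p
    have q3 : G p (S y) p ≤ 0 := by nlinarith
    symm
    apply eqz
    intro ε hε
    rw [g4]
    linarith
  have TB : ∀ x ∈ B, T x = p := by
    intro x hx
    obtain ⟨z, hz, e⟩ := hTB ⟨x, hx, rfl⟩
    rw [← e, SA z hz]
  have TC : ∀ x ∈ C, T x = p := by
    intro x hx
    obtain ⟨z, hz, e⟩ := hTC ⟨x, hx, rfl⟩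
    rw [← e, SB z hz]
  obtain ⟨b', hb', eb⟩ := hSC ⟨c, hc, rfl⟩
  obtain ⟨a', ha', ea⟩ := hSB ⟨b, hb, rfl⟩
  rw [SC c hc] at eb
  rw [SB b hb] at ea
  let x : ℕ → X := fun n => if n % 3 = 0 then a' else if n % 3 = 1 then c else b'
  have x0 : ∀ n, x (3 * n) = a' := by intro n; simp [x]
  have x1 : ∀ n, x (3 * n + 1) = c := by
    intro n
    have : (3 * n + 1) % 3 = 1 := by omega
    simp [x, this]
  have x2 : ∀ n, x (3 * n + 2) = b' := by
    intro n
    have : (3 * n + 2) % 3 = 2 := by omega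
    simp [x, this]
  have xall : ∀ n, T (x n) = p ∧ S (x n) = p ∧ K (x n) = p := by
    intro n
    simp only [x]
    split_ifs
    · exact ⟨TA _ ha', SA _ ha', ea⟩
    · exact ⟨TC _ hc, SC _ hc, hp c hc⟩
    · exact ⟨TB _ hb', SB _ hb', eb⟩
  refine ⟨x, ⟨by simpa using (x0 0).symm ▸ ha', fun n => (x0 n).symm ▸ ha',
    fun n => (x1 n).symm ▸ hc, fun n => (x2 n).symm ▸ hb', fun n => ?_⟩, ?_⟩
  · rw [(xall n).1, (xall (n + 1)).2.1, (xall (n + 2)).2.2]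
    exact ⟨rfl, rfl⟩
  · simp only [fun n => (xall n).1, g1]
    exact tendsto_const_nhds
end

section
/- Let (A,B,C) be a triple of nonempty subsets of a G-metric space (X,G) and let (T;S;K) be a tripartite semi-contraction on A∪B∪C such that T(A) ⊆ S(C) ⊆ K(B), T(B) ⊆ S(A) ⊆ K(C), T(C) ⊆ S(B) ⊆ K(A), and such that S is G-continuous on A∪B∪C. Let (x_n) be a sequence with x_0 ∈ A, x_{3n} ∈ A, x_{3n+1} ∈ C, x_{3n+2} ∈ B for all n, and T x_n = S x_{n+1} = K x_{n+2} for all n ≥ 0. If (x_{3n}) has a subsequence that G-converges to a point of A, then there exists p ∈ A with G(Kp, Tp, Sp) = G(A,B,C), i.e. (T;S;K) has a tripartite coincidence-best proximity point in A. -/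
open Filter Topology Set

lemma gm_rot {X : Type*} {G : X → X → X → ℝ} (hG : IsGMetric G) (x y : X) :
    G y x x ≤ 2 * G x y y := by
  obtain ⟨h0, h1, h2, h3, h4, h5, h6⟩ := hG
  have := h6 x y x y
  have e1 : G x y x = G y x x := h5 x y x
  have e2 : G y y x = G x y y := by rw [h5, h5]
  linarith

lemma gm_two {X : Type*} {G : X → X → X → ℝ} (hG : IsGMetric G) (x y z : X) :
    G x x y ≤ 2 * G x y z := by
  have hr := gm_rot hG x y
  obtain ⟨h0, h1, h2, h3, h4, h5, h6⟩ := hG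
  by_cases h : z = y
  · subst h
    have e1 : G x x z = G z x x := by rw [h5, h5]
    linarith
  · have := h3 x y z h
    have := h0 x y z
    linarith

lemma gm_lim {X : Type*} {G : X → X → X → ℝ} (hG : IsGMetric G) (a b : ℕ → X) (u w : X)
    (ha : GConv G a u) (hb : GConv G b u) (f : ℕ → ℝ) (hf : Tendsto f atTop (𝓝 0))
    (h : ∀ n, G (a n) (b n) w ≤ f n) : w = u := by
  have key : ∀ n, G u u w ≤ 2 * G (a n) u u + (2 * G (b n) u u + f n) := by
    intro n
    have r1 := gm_rot hG (a n) u
    have r2 := gm_rot hG (b n) u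
    have hn := h n
    obtain ⟨h0, h1, h2, h3, h4, h5, h6⟩ := hG
    have q1 := h6 u u w (a n)
    have q2 := h6 u w (a n) (b n)
    have e1 : G u w (a n) = G (a n) u w := by rw [h5, h5]
    have e2 : G (b n) w (a n) = G (a n) (b n) w := by rw [h5, h5]
    linarith
  have hl : Tendsto (fun n => 2 * G (a n) u u + (2 * G (b n) u u + f n)) atTop (𝓝 0) := by
    have := (Tendsto.const_mul 2 ha).add ((Tendsto.const_mul 2 hb).add hf)
    simpa using this
  have hle : G u u w ≤ 0 := ge_of_tendsto' hl key
  by_contra hne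
  have := hG.2.2.1 u w (Ne.symm hne)
  linarith

lemma gm_sum {X : Type*} {G : X → X → X → ℝ} (hG : IsGMetric G) (a b u : X) :
    G a b u ≤ G a u u + G b u u := by
  obtain ⟨h0, h1, h2, h3, h4, h5, h6⟩ := hG
  have q := h6 a b u u
  have e : G u b u = G b u u := h5 u b u
  linarith

lemma gm_step {X : Type*} {G : X → X → X → ℝ} (hG : IsGMetric G) (x y u : X) (z : X) :
    G y u u ≤ 4 * G x y z + G x u u := by
  have q1 := gm_two hG x y z
  have q0 := hG.1 x y z
  have q3 := hG.2.2.2.2.2.2 y u u x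
  have e : G x x y = G y x x := by rw [hG.2.2.2.2.2.1, hG.2.2.2.2.2.1]
  linarith

lemma gm_eq {X : Type*} {G : X → X → X → ℝ} (hG : IsGMetric G) (u w : X)
    (h : G u u w ≤ 0) : w = u := by
  by_contra hne
  have := hG.2.2.1 u w (Ne.symm hne)
  linarith

/-- Theorem 4.6: existence of a tripartite coincidence-best proximity point
for a tripartite semi-contraction, assuming `S` is `G`-continuous and `(x_{3n})` has a
`G`-convergent subsequence in `A`. -/
theorem tripartite_semi_contraction_best_proximity_of_subseq
    {X : Type*} (G : X → X → X → ℝ) (hG : IsGMetric G)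
    (A B C : Set X) (hA : A.Nonempty) (hB : B.Nonempty) (hC : C.Nonempty)
    (T S K : X → X) (r : ℝ)
    (hTSK : TripartiteSemiContraction G A B C T S K r)
    (hTA : T '' A ⊆ S '' C) (hSC : S '' C ⊆ K '' B)
    (hTB : T '' B ⊆ S '' A) (hSA : S '' A ⊆ K '' C)
    (hTC : T '' C ⊆ S '' B) (hSB : S '' B ⊆ K '' A)
    (hS : GContinuousOn G S (A ∪ B ∪ C))
    (x : ℕ → X) (hx : IterSeq A B C T S K x)
    (hsub : ∃ φ : ℕ → ℕ, StrictMono φ ∧ ∃ q ∈ A, GConv G (fun k => x (3 * φ k)) q) :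
    ∃ p ∈ A, G (K p) (T p) (S p) = GDist G A B C := by
  obtain ⟨hRLN, hr0, hr1, hc⟩ := hTSK
  obtain ⟨-, hxA, hxC, hxB, hrec⟩ := hx
  obtain ⟨hT1, hT2, hT3, hS1, hS2, hS3, hK1, hK2, hK3⟩ := hRLN
  obtain ⟨φ, hφ, q, hq, hconv⟩ := hsub
  have h0 := hG.1
  have h1 := hG.2.1
  have h4 := hG.2.2.2.2.1
  have h5 := hG.2.2.2.2.2.1
  have hDle : ∀ a ∈ A, ∀ b ∈ B, ∀ c ∈ C, GDist G A B C ≤ G a b c := by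
    intro a ha b hb c hc
    refine csInf_le ⟨0, ?_⟩ ⟨a, ha, b, hb, c, hc, rfl⟩
    rintro _ ⟨a, -, b, -, c, -, rfl⟩
    exact h0 _ _ _
  have hD0 : 0 ≤ GDist G A B C := by
    apply Real.sInf_nonneg
    rintro _ ⟨a, -, b, -, c, -, rfl⟩
    exact h0 _ _ _
  set D := GDist G A B C with hD
  have hmain : ∀ a ∈ A, ∀ b ∈ B, ∀ c ∈ C,
      G (S a) (S b) (S c) ≤ r * (r * G (K a) (K b) (K c) + (1 - r) * D) ∧
      D ≤ G (S a) (S b) (S c) := by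
    intro a ha b hb c hcc
    obtain ⟨c1, c2⟩ := hc a ha b hb c hcc
    refine ⟨c2.trans (mul_le_mul_of_nonneg_left c1 hr0.le), ?_⟩
    have := hDle _ (hS3 hb) _ (hS2 hcc) _ (hS1 ha)
    rwa [← h5] at this
  let s : ℕ → ℝ := fun n => G (S (x n)) (S (x (n+1))) (S (x (n+2)))
  have hsk : ∀ n, s n ≤ r * (r * G (K (x n)) (K (x (n+1))) (K (x (n+2))) + (1 - r) * D) ∧
      D ≤ s n := by
    intro n
    obtain ⟨m, rfl | rfl | rfl⟩ : ∃ m, n = 3*m ∨ n = 3*m+1 ∨ n = 3*m+2 := ⟨n/3, by omega⟩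
    · have := hmain _ (hxA m) _ (hxB m) _ (hxC m)
      rw [h4 (S _), h4 (K _)] at this
      exact this
    · have := hmain _ (hxA (m+1)) _ (hxB m) _ (hxC m)
      rw [h5 (S _), h5 (K _), h4 (S _), h4 (K _), h5 (S _), h5 (K _),
        h5 (S _), h5 (K _)] at this
      exact this
    · have := hmain _ (hxA (m+1)) _ (hxB m) _ (hxC (m+1))
      rw [h5 (S _), h5 (K _), h4 (S _), h4 (K _)] at this
      exact this
  have hrecs : ∀ n, s (n+2) ≤ r * (r * s (n+1) + (1 - r) * D) := by
    intro n
    have := (hsk (n+2)).1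
    rw [← (hrec n).2, ← (hrec (n+1)).2, ← (hrec (n+2)).2] at this
    exact this
  have hL : r * D / (1 + r) * (1 + r) = r * D := by field_simp
  set L := r * D / (1 + r) with hLdef
  have hgeo : ∀ n, s (n+1) - L ≤ (r^2)^n * (s 1 - L) := by
    intro n
    induction n with
    | zero => simp
    | succ n ih =>
      have := hrecs n
      have h' := mul_le_mul_of_nonneg_left ih (sq_nonneg r)
      have e : (r^2)^(n+1) * (s 1 - L) = r^2 * ((r^2)^n * (s 1 - L)) := by ring
      have e2 : r * (r * s (n+1) + (1 - r) * D) = r^2 * (s (n+1) - L) + L := by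
        linear_combination (1 - r) * (-hL)
      rw [e]
      change s (n+2) - L ≤ _
      linarith
  have hpow : Tendsto (fun n => (r^2)^n * (s 1 - L)) atTop (𝓝 0) := by
    have := (tendsto_pow_atTop_nhds_zero_of_lt_one (sq_nonneg r)
      (by nlinarith : r^2 < 1)).mul_const (s 1 - L)
    simpa using this
  have hDL : D - L ≤ 0 := by
    refine ge_of_tendsto' hpow (fun n => ?_)
    have := (hsk (n+1)).2
    have := hgeo n
    linarith
  have hDz : D = 0 := by nlinarith
  have hLz : L = 0 := by rw [hLdef, hDz]; simp
  have hs0 : Tendsto s atTop (𝓝 0) := by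
    rw [← tendsto_add_atTop_iff_nat 1]
    refine squeeze_zero (fun n => h0 _ _ _) (fun n => ?_) hpow
    have := hgeo n
    rw [hLz] at this ⊢
    simpa using this
  have hcj : ∀ j, GConv G (fun k => S (x (3 * φ k + j))) (S q) := by
    intro j
    induction j with
    | zero =>
      exact hS _ q (fun n => Or.inl (Or.inl (hxA _))) (Or.inl (Or.inl hq)) hconv
    | succ j ih =>
      have ht : Tendsto (fun k => 3 * φ k + j) atTop atTop :=
        tendsto_atTop_mono (fun k => by have := hφ.id_le k; simp only [id] at this ⊢; omega)
          tendsto_id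
      have hl := (Tendsto.const_mul 4 (hs0.comp ht)).add ih
      simp only [mul_zero, add_zero] at hl
      exact squeeze_zero (fun n => h0 _ _ _) (fun k => gm_step hG _ _ _ _) hl
  set u := S q with hu
  obtain ⟨z, hz, hKz⟩ := hSA ⟨q, hq, rfl⟩
  have hSz : S z = u := by
    have hl := Tendsto.const_mul r ((hcj 1).add (hcj 2))
    simp only [mul_zero, add_zero] at hl
    refine gm_lim hG _ _ u _ (hcj 0) (hcj 2) _ hl (fun k => ?_)
    refine (hc _ (hxA (φ k)) _ (hxB (φ k)) z hz).2.trans ?_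
    rw [(hrec _).1, hKz]
    exact mul_le_mul_of_nonneg_left (gm_sum hG _ _ _) hr0.le
  have huC : GConv G (fun _ => u) u := by
    unfold GConv
    simp [h1]
  rw [← hu] at hKz
  obtain ⟨b, hb, hKb⟩ := hSC ⟨z, hz, rfl⟩
  rw [hSz] at hKb
  have hSb : S b = u := by
    have hl := Tendsto.const_mul r (hcj 2)
    simp only [mul_zero] at hl
    refine gm_lim hG _ _ u _ (hcj 4) huC _ hl (fun k => ?_)
    have := (hc _ (hxA (φ k + 1)) b hb z hz).1
    rw [hDz, hKz, hKb, (hrec _).1, h4,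
      show 3 * (φ k + 1) = 3 * φ k + 1 + 2 by ring, ← (hrec _).2] at this
    simpa using this
  obtain ⟨a, ha, hKa⟩ := hSB ⟨b, hb, rfl⟩
  rw [hSb] at hKa
  obtain ⟨c1, c2⟩ := hc a ha b hb z hz
  rw [hDz, hKa, hKb, hKz, hSb, h1] at c1
  rw [hKz, hSb, hSz] at c2
  have hTa : T a = u := gm_eq hG _ _ (by rw [← h5]; simpa using c1)
  have hSa : S a = u := gm_eq hG _ _ (by
    rw [hTa, h1] at c2
    rw [← h5]; simpa using c2)
  refine ⟨a, ha, ?_⟩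
  rw [hKa, hTa, hSa, h1, hDz]
end

section
/- Let (A,B,C) be a triple of nonempty subsets of a G-metric space (X,G) such that A is G-sequentially compact, and let (T;S;K) be a tripartite semi-contraction on A∪B∪C such that T(A) ⊆ S(C) ⊆ K(B), T(B) ⊆ S(A) ⊆ K(C), T(C) ⊆ S(B) ⊆ K(A), and such that S and K commute on A∪C (K(Sx) = S(Kx) for all x ∈ A∪C). If K is tripartite relatively anti-Lipschitzian and G-continuous on A∪B∪C, then (T;S;K) has a tripartite coincidence-best proximity point in A, i.e. there exists p ∈ A with G(Kp, Tp, Sp) = G(A,B,C). -/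
open Filter Topology Set

/-- Existence of a symmetric distance associated to a G-metric. -/
theorem exists_sym_dist {X : Type*} (G : X → X → X → ℝ) (hG : IsGMetric G) :
    ∃ e : X → X → ℝ, (∀ x y, 0 ≤ e x y) ∧ (∀ x y, e x y ≤ 0 → x = y) ∧ (∀ x, e x x = 0) ∧
      (∀ x y, e x y = e y x) ∧ (∀ x y z, e x z ≤ e x y + e y z) ∧
      (∀ x y, G x y y ≤ e x y) ∧ (∀ x y, e x y ≤ 3 * G x y y) ∧
      (∀ x y z, e x y ≤ 4 * G x y z) ∧ (∀ x y z a, G x y z ≤ e x a + e y a + e z a) := by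
  obtain ⟨h0, h1, h2, h3, h4, h5, h6⟩ := hG
  have hd : ∀ x y, G x x y ≤ 2 * G x y y := by
    intro x y
    have a1 := h6 x x y y
    have a2 : G y x y = G x y y := by rw [h5 y x y]
    linarith
  have hxy : ∀ x y z, G x x y ≤ 2 * G x y z := by
    intro x y z
    by_cases h : z = y
    · subst h; exact hd x z
    · have := h3 x y z h
      have := h0 x y z
      linarith
  have sw : ∀ x y, G x y y = G y y x := fun x y => h5 x y y
  refine ⟨fun x y => G x x y + G y y x, ?_, ?_, ?_, ?_, ?_, ?_, ?_, ?_, ?_⟩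
  · intro x y; have := h0 x x y; have := h0 y y x; dsimp only; linarith
  · intro x y h
    by_contra hne
    have := h2 x y hne; have := h0 y y x; dsimp only at h; linarith
  · intro x; simp [h1]
  · intro x y; dsimp only; ring
  · intro x y z
    have a1 := h6 x z z y
    have a2 := h6 z x x y
    rw [sw x z, sw x y, sw y z] at a1
    rw [sw z x, sw z y, sw y x] at a2
    dsimp only; linarith
  · intro x y; have := sw x y; have := h0 x x y; dsimp only; linarith
  · intro x y; have := sw x y; have := hd x y; dsimp only; linarith
  · intro x y z
    have a1 := hxy x y z
    have a2 := hxy y x z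
    have a3 : G y x z = G x y z := by rw [h5 y x z, h4 x z y]
    dsimp only; linarith
  · intro x y z a
    have a1 := h6 x y z a
    have a2 := h6 y z a a
    have a3 : G a y z = G y z a := h5 a y z
    have a4 : G a z a = G z a a := h5 a z a
    have := sw x a; have := sw y a; have := sw z a
    have := h0 x x a; have := h0 y y a; have := h0 z z a
    dsimp only; linarith

/-- Theorem 4.8: existence of a tripartite coincidence-best proximity point
for a tripartite semi-contraction when `A` is `G`-sequentially compact. -/
theorem tripartite_semi_contraction_best_proximity_of_seq_compact
    {X : Type*} (G : X → X → X → ℝ) (hG : IsGMetric G)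
    (A B C : Set X) (hA : A.Nonempty) (hB : B.Nonempty) (hC : C.Nonempty)
    (hAcpt : GSeqCompact G A)
    (T S K : X → X) (r : ℝ)
    (hTSK : TripartiteSemiContraction G A B C T S K r)
    (hTA : T '' A ⊆ S '' C) (hSC : S '' C ⊆ K '' B)
    (hTB : T '' B ⊆ S '' A) (hSA : S '' A ⊆ K '' C)
    (hTC : T '' C ⊆ S '' B) (hSB : S '' B ⊆ K '' A)
    (hcomm : ∀ x ∈ A ∪ C, K (S x) = S (K x))
    (hanti : GAntiLipschitz G K A B C)
    (hKcont : GContinuousOn G K (A ∪ B ∪ C)) :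
    ∃ p ∈ A, G (K p) (T p) (S p) = GDist G A B C := by
  obtain ⟨⟨-, -, -, hSA', hSC', hSB', hKA, hKB, hKC⟩, hr0, hr1, hcon⟩ := hTSK
  have hGn : ∀ x y z, 0 ≤ G x y z := hG.1
  have hrot : ∀ x y z, G x y z = G y z x := hG.2.2.2.2.2.1
  have hsw : ∀ x y z, G x y z = G x z y := hG.2.2.2.2.1
  have hzero : ∀ x, G x x x = 0 := hG.2.1
  obtain ⟨e, e0, eeq, exx, esym, etri, eG, eG3, e4, eS⟩ := exists_sym_dist G hG
  obtain ⟨c, hc, hanti⟩ := hanti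
  have hD0 : 0 ≤ GDist G A B C := by
    apply Real.sInf_nonneg
    rintro d ⟨a, -, b, -, c, -, rfl⟩
    exact hGn _ _ _
  have hDle : ∀ a ∈ A, ∀ b ∈ B, ∀ c ∈ C, GDist G A B C ≤ G a b c := by
    intro a ha b hb c hc
    apply csInf_le
    · refine ⟨0, ?_⟩
      rintro d ⟨a, -, b, -, c, -, rfl⟩
      exact hGn _ _ _
    · exact ⟨a, ha, b, hb, c, hc, rfl⟩
  -- the iterative sequences
  obtain ⟨a0, ha0⟩ := hA
  obtain ⟨b0, hb0⟩ := hB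
  obtain ⟨c0, hc0⟩ := hC
  have hstep : ∀ t : {t : X × X × X // t.1 ∈ A ∧ t.2.1 ∈ B ∧ t.2.2 ∈ C},
      ∃ s : {t : X × X × X // t.1 ∈ A ∧ t.2.1 ∈ B ∧ t.2.2 ∈ C},
        K s.1.1 = S t.1.2.1 ∧ K s.1.2.1 = S t.1.2.2 ∧ K s.1.2.2 = S t.1.1 := by
    rintro ⟨⟨x, y, z⟩, hx, hy, hz⟩
    obtain ⟨x', hx', h1⟩ := hSB ⟨y, hy, rfl⟩
    obtain ⟨y', hy', h2⟩ := hSC ⟨z, hz, rfl⟩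
    obtain ⟨z', hz', h3⟩ := hSA ⟨x, hx, rfl⟩
    exact ⟨⟨⟨x', y', z'⟩, hx', hy', hz'⟩, h1, h2, h3⟩
  choose f hf using hstep
  let t : ℕ → {t : X × X × X // t.1 ∈ A ∧ t.2.1 ∈ B ∧ t.2.2 ∈ C} :=
    fun n => Nat.rec ⟨⟨a0, b0, c0⟩, ha0, hb0, hc0⟩ (fun _ s => f s) n
  obtain ⟨x, y, z, hx, hy, hz, hKx, hKy, hKz⟩ : ∃ x y z : ℕ → X, (∀ n, x n ∈ A) ∧
      (∀ n, y n ∈ B) ∧ (∀ n, z n ∈ C) ∧ (∀ n, K (x (n+1)) = S (y n)) ∧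
      (∀ n, K (y (n+1)) = S (z n)) ∧ (∀ n, K (z (n+1)) = S (x n)) :=
    ⟨fun n => (t n).1.1, fun n => (t n).1.2.1, fun n => (t n).1.2.2, fun n => (t n).2.1,
      fun n => (t n).2.2.1, fun n => (t n).2.2.2, fun n => (hf (t n)).1,
      fun n => (hf (t n)).2.1, fun n => (hf (t n)).2.2⟩
  obtain ⟨g, hg⟩ : ∃ g : ℕ → ℝ, ∀ n, g n = G (K (x n)) (K (y n)) (K (z n)) := ⟨_, fun _ => rfl⟩
  have hg0 : ∀ n, 0 ≤ g n := fun n => by rw [hg]; exact hGn _ _ _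
  have hrec : ∀ n, g (n+1) ≤ r^2 * g n + r * (1 - r) * GDist G A B C := by
    intro n
    obtain ⟨h1, h2⟩ := hcon _ (hx n) _ (hy n) _ (hz n)
    have h3 : g (n+1) = G (S (x n)) (S (y n)) (S (z n)) := by
      rw [hg, hKx, hKy, hKz]; exact (hrot _ _ _).symm
    rw [h3]
    rw [← hg] at h1
    have := mul_le_mul_of_nonneg_left h1 hr0.le
    nlinarith
  have hq0 : 0 ≤ r^2 := by positivity
  have hq1 : r^2 < 1 := by nlinarith
  have hpow : Tendsto (fun n : ℕ => (r^2)^n) atTop (𝓝 0) :=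
    tendsto_pow_atTop_nhds_zero_of_lt_one hq0 hq1
  have hbd : ∀ n, g n ≤ (r^2)^n * g 0 + r * GDist G A B C := by
    intro n
    induction n with
    | zero => have := mul_nonneg hr0.le hD0; simp; linarith
    | succ n ih =>
      have h1 := hrec n
      have h2 := mul_le_mul_of_nonneg_left ih hq0
      have h3 : 0 ≤ r * GDist G A B C * (r * (1 - r)) := 
        mul_nonneg (mul_nonneg hr0.le hD0) (mul_nonneg hr0.le (by linarith))
      rw [pow_succ (r^2)]
      nlinarith
  have hD : GDist G A B C = 0 := by
    have h1 : Tendsto (fun n : ℕ => (r^2)^n * g 0 + r * GDist G A B C) atTop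
        (𝓝 (0 * g 0 + r * GDist G A B C)) := (hpow.mul_const _).add_const _
    have h2 : GDist G A B C ≤ 0 * g 0 + r * GDist G A B C := by
      refine ge_of_tendsto' h1 fun n => le_trans ?_ (hbd n)
      rw [hg]
      exact hDle _ (hKA (hx n)) _ (hKB (hy n)) _ (hKC (hz n))
    nlinarith
  rw [hD] at hbd hcon ⊢
  simp only [mul_zero, add_zero] at hbd hcon
  have hcon1 : ∀ x ∈ A, ∀ y ∈ B, ∀ z ∈ C,
      G (T x) (S y) (K z) ≤ G (K x) (K y) (K z) ∧
      G (S x) (S y) (S z) ≤ G (K x) (K y) (K z) := by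
    intro x hx y hy z hz
    obtain ⟨h1, h2⟩ := hcon x hx y hy z hz
    have := hGn (K x) (K y) (K z)
    have := hGn (T x) (S y) (K z)
    constructor <;> nlinarith
  have hgt : Tendsto g atTop (𝓝 0) := by
    refine squeeze_zero hg0 hbd ?_
    simpa using hpow.mul_const (g 0)
  have hSyKz : ∀ n, e (S (y n)) (K (z n)) ≤ 4 * g n := by
    intro n
    have h1 := (hcon1 _ (hx n) _ (hy n) _ (hz n)).1
    have h2 := e4 (S (y n)) (K (z n)) (T (x n))
    rw [← hrot] at h2
    rw [← hg n] at h1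
    linarith
  have hKyKz : ∀ n, e (K (y n)) (K (z n)) ≤ 4 * g n := by
    intro n
    have h2 := e4 (K (y n)) (K (z n)) (K (x n))
    rw [← hrot, ← hg n] at h2
    linarith
  have hxy : ∀ n, e (x n) (y n) ≤ 4 * c * g n := by
    intro n
    have h2 := e4 (x n) (y n) (z n)
    have h3 := hanti _ (hx n) _ (hy n) _ (hz n)
    rw [← hg n] at h3
    linarith
  have hxz : ∀ n, e (x n) (z n) ≤ 4 * c * g n := by
    intro n
    have h2 := e4 (x n) (z n) (y n)
    have h3 := hanti _ (hx n) _ (hy n) _ (hz n)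
    rw [← hg n] at h3
    rw [← hsw] at h2
    linarith
  have hx'y : ∀ n, e (x (n+1)) (y n) ≤ 32 * c * g n := by
    intro n
    have h2 := e4 (x (n+1)) (y n) (z n)
    have h3 := hanti _ (hx (n+1)) _ (hy n) _ (hz n)
    have h4 := eS (K (x (n+1))) (K (y n)) (K (z n)) (K (z n))
    rw [exx, hKx] at h4
    rw [hKx] at h3
    have h5 : G (S (y n)) (K (y n)) (K (z n)) ≤ 8 * g n := by
      have := hSyKz n; have := hKyKz n; linarith
    have := mul_le_mul_of_nonneg_left h5 hc.le
    linarith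
  have hstepx : ∀ n, e (x (n+1)) (x n) ≤ 36 * c * g 0 * (r^2)^n := by
    intro n
    have h1 := etri (x (n+1)) (y n) (x n)
    have h2 := hx'y n
    have h3 := hxy n
    rw [esym] at h3
    have := mul_le_mul_of_nonneg_left (hbd n) hc.le
    linarith
  have hM0 : 0 ≤ 36 * c * g 0 := by have := hg0 0; positivity
  have hbdx : ∀ n, e (x n) (x 0) * (1 - r^2) ≤ 36 * c * g 0 * (1 - (r^2)^n) := by
    intro n
    induction n with
    | zero => simp [exx]
    | succ n ih =>
      have h1 := (etri (x (n+1)) (x n) (x 0)).trans (add_le_add_left (hstepx n) _)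
      have h2 := mul_le_mul_of_nonneg_right h1 (sub_nonneg.2 hq1.le)
      rw [pow_succ (r^2)]
      linarith
  have hGB : GBounded G x := by
    refine ⟨x 0, x 0, 36 * c * g 0 / (1 - r^2) + 1, ?_, ?_⟩
    · have := div_nonneg hM0 (sub_nonneg.2 hq1.le); linarith
    · intro n
      have h1 : e (x n) (x 0) ≤ 36 * c * g 0 / (1 - r^2) := by
        rw [le_div_iff₀ (sub_pos.2 hq1)]
        have := mul_nonneg hM0 (pow_nonneg hq0 n)
        have := hbdx n
        linarith
      have := eG (x n) (x 0)
      linarith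
  obtain ⟨φ, hφ, p, hp, hconv⟩ := hAcpt x hx hGB
  have hgφ : Tendsto (fun k => g (φ k)) atTop (𝓝 0) := hgt.comp hφ.tendsto_atTop
  have hex : Tendsto (fun k => e (x (φ k)) p) atTop (𝓝 0) := by
    refine squeeze_zero (fun _ => e0 _ _) (fun k => eG3 _ _) ?_
    simpa using Tendsto.const_mul 3 hconv
  have key : ∀ w : ℕ → X, (∀ n, w n ∈ A ∪ B ∪ C) → (∀ n, e (x n) (w n) ≤ 4 * c * g n) →
      Tendsto (fun k => e (K (w (φ k))) (K p)) atTop (𝓝 0) := by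
    intro w hw hxw
    have h1 : GConv G (fun k => w (φ k)) p := by
      refine squeeze_zero (fun _ => hGn _ _ _) 
        (g := fun k => 4 * c * g (φ k) + e (x (φ k)) p) (fun k => ?_) ?_
      · have h1 := eG (w (φ k)) p
        have h2 := etri (w (φ k)) (x (φ k)) p
        have h3 := hxw (φ k)
        rw [esym] at h3
        linarith
      · simpa using (hgφ.const_mul (4 * c)).add hex
    have h2 := hKcont _ p (fun k => hw (φ k)) (Or.inl (Or.inl hp)) h1
    refine squeeze_zero (fun _ => e0 _ _) (fun k => eG3 _ _) ?_
    simpa using Tendsto.const_mul 3 h2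
  have hKyp := key y (fun n => Or.inl (Or.inr (hy n))) hxy
  have hKzp := key z (fun n => Or.inr (hz n)) hxz
  have hlim : Tendsto (fun k => 4 * (e (K (y (φ k))) (K p) + e (K (z (φ k))) (K p))
      + 4 * g (φ k) + e (K (z (φ k))) (K p)) atTop (𝓝 0) := by
    simpa using (((hKyp.add hKzp).const_mul 4).add (hgφ.const_mul 4)).add hKzp
  have hGK : ∀ k, G (K p) (K (y k)) (K (z k)) ≤ e (K (y k)) (K p) + e (K (z k)) (K p) := by
    intro k
    have := eS (K p) (K (y k)) (K (z k)) (K p)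
    rw [exx] at this
    linarith
  have hT : T p = K p := by
    apply eeq
    refine ge_of_tendsto' hlim fun k => ?_
    have h1 := (hcon1 p hp _ (hy (φ k)) _ (hz (φ k))).1
    have h2 := e4 (T p) (K (z (φ k))) (S (y (φ k)))
    rw [← hsw] at h2
    have h3 := etri (T p) (K (z (φ k))) (K p)
    have h4 := hGK (φ k)
    have h5 := hg0 (φ k)
    linarith
  have hS : S p = K p := by
    apply eeq
    refine ge_of_tendsto' hlim fun k => ?_
    have h1 := (hcon1 p hp _ (hy (φ k)) _ (hz (φ k))).2
    have h2 := e4 (S p) (S (y (φ k))) (S (z (φ k)))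
    have h3 := etri (S p) (S (y (φ k))) (K p)
    have h3' := etri (S (y (φ k))) (K (z (φ k))) (K p)
    have h4 := hGK (φ k)
    have h5 := hSyKz (φ k)
    linarith
  exact ⟨p, hp, by rw [hT, hS, hzero]⟩
end
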